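/- Let $R$ be a commutative ring and $\{M_e\}$ an inverse system of $R$-modules with surjective transition maps. Then for any $R$-module $N$ that is finitely generated, the natural map $(\varprojlim M_e) \otimes_R N \to \varprojlim(M_e \otimes_R N)$ is surjective. -/

import Mathlib

open Function TensorProduct

section

variable (R : Type*) [CommRing R] (M : ℕ → Type*) [∀ e, AddCommGroup (M e)]
  [∀ e, Module R (M e)] (φ : ∀ e, M (e + 1) →ₗ[R] M e)

/-- The map `id - shift` on the product of an inverse system of modules. -/
def shiftL : ((e : ℕ) → M e) →ₗ[R] ((e : ℕ) → M e) where
  toFun a := fun e => a e - φ e (a (e + 1))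
  map_add' a b := by funext e; simp only [Pi.add_apply, map_add]; abel
  map_smul' r a := by funext e; simp [smul_sub]

/-- The inverse limit `lim M_e` of an inverse system of modules. -/
def limL : Submodule R ((e : ℕ) → M e) := LinearMap.ker (shiftL R M φ)

/-- The projection `lim M_e → M_e`. -/
def projL (e : ℕ) : limL R M φ →ₗ[R] M e := (LinearMap.proj e).comp (limL R M φ).subtype

lemma projL_succ (e : ℕ) : (φ e).comp (projL R M φ (e + 1)) = projL R M φ e := by
  ext a
  have h := congrFun (LinearMap.mem_ker.mp a.2) e
  have h' : a.1 e - φ e (a.1 (e + 1)) = 0 := h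
  show φ e (a.1 (e + 1)) = a.1 e
  rw [eq_comm, ← sub_eq_zero]; exact h'

/-- The natural map `(lim M_e) ⊗ E → lim (M_e ⊗ E)`. -/
noncomputable def natTensorMap (E : Type*) [AddCommGroup E] [Module R E] :
    ((limL R M φ) ⊗[R] E) →ₗ[R]
      limL R (fun e => (M e) ⊗[R] E) (fun e => LinearMap.rTensor E (φ e)) :=
  LinearMap.codRestrict _
    (LinearMap.pi fun e => (LinearMap.rTensor E (projL R M φ e)))
    (fun c => by
      simp only [limL, LinearMap.mem_ker]
      funext e
      show LinearMap.rTensor E (projL R M φ e) c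
          - LinearMap.rTensor E (φ e) (LinearMap.rTensor E (projL R M φ (e + 1)) c) = 0
      rw [← LinearMap.comp_apply, ← LinearMap.rTensor_comp, projL_succ, sub_self])


/-- For a surjection `p : F → N` of modules and a surjection `φ : A → B`, the map from `A ⊗ F` to the
fibre product of `B ⊗ F` and `A ⊗ N` over `B ⊗ N` is surjective. -/
lemma exists_rTensor_eq_and_lTensor_eq {S A B F N : Type*} [CommRing S] [AddCommGroup A]
    [Module S A] [AddCommGroup B] [Module S B] [AddCommGroup F] [Module S F] [AddCommGroup N]
    [Module S N] {φ : A →ₗ[S] B} (hφ : Surjective φ) {p : F →ₗ[S] N} (hp : Surjective p)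
    (x : B ⊗[S] F) (c : A ⊗[S] N) (h : p.lTensor B x = φ.rTensor N c) :
    ∃ y : A ⊗[S] F, φ.rTensor F y = x ∧ p.lTensor A y = c := by
  obtain ⟨y, rfl⟩ := LinearMap.lTensor_surjective A hp c
  have hA := lTensor_exact A (LinearMap.exact_subtype_ker_map p) hp
  have hB := lTensor_exact B (LinearMap.exact_subtype_ker_map p) hp
  have hxy : p.lTensor B (x - φ.rTensor F y) = 0 := by
    rw [map_sub, h, ← LinearMap.comp_apply, ← LinearMap.comp_apply,
      LinearMap.rTensor_comp_lTensor, LinearMap.lTensor_comp_rTensor, sub_self]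
  obtain ⟨t, ht⟩ := (hB _).mp hxy
  obtain ⟨t, rfl⟩ := LinearMap.rTensor_surjective _ hφ t
  refine ⟨y + (LinearMap.ker p).subtype.lTensor A t, ?_, ?_⟩
  · rw [map_add, ← LinearMap.comp_apply (φ.rTensor F) (LinearMap.lTensor _ _),
      LinearMap.rTensor_comp_lTensor, ← LinearMap.lTensor_comp_rTensor, LinearMap.comp_apply, ht,
      add_sub_cancel]
  · rw [map_add, hA.apply_apply_eq_zero, add_zero]

/-- An inverse sequence of types in which every element satisfying `P` lifts to one satisfying `P`
has a compatible family of elements satisfying `P`. -/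
lemma exists_compatible_seq {X : ℕ → Type*} (f : ∀ e, X (e + 1) → X e) (P : ∀ e, X e → Prop)
    (h0 : ∃ x, P 0 x) (hs : ∀ e x, P e x → ∃ y, f e y = x ∧ P (e + 1) y) :
    ∃ x : ∀ e, X e, (∀ e, f e (x (e + 1)) = x e) ∧ ∀ e, P e (x e) := by
  obtain ⟨x₀, hx₀⟩ := h0
  choose g hg hgP using hs
  let u : ∀ e, {x : X e // P e x} :=
    fun e => Nat.rec ⟨x₀, hx₀⟩ (fun e x => ⟨g e x.1 x.2, hgP e x.1 x.2⟩) e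
  exact ⟨fun e => (u e).1, fun e => hg e _ (u e).2, fun e => (u e).2⟩

lemma mem_limL_iff (a : (e : ℕ) → M e) :
    a ∈ limL R M φ ↔ ∀ e, φ e (a (e + 1)) = a e := by
  rw [limL, LinearMap.mem_ker, funext_iff]
  exact forall_congr' fun e => sub_eq_zero.trans eq_comm

/-- If the transition maps of `{M_e}` are surjective, then for any finitely generated
module `N` the natural map `(lim M_e) ⊗ N → lim (M_e ⊗ N)` is surjective. -/
theorem natTensorMap_surjective (hφ : ∀ e, Function.Surjective (φ e))
    (N : Type*) [AddCommGroup N] [Module R N] [Module.Finite R N] :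
    Function.Surjective (natTensorMap R M φ N) := by
  classical
  obtain ⟨n, p, hp⟩ := Module.Finite.exists_fin' R N
  rintro ⟨c, hc⟩
  rw [mem_limL_iff] at hc
  obtain ⟨x, hx, hxc⟩ := exists_compatible_seq (X := fun e => M e ⊗[R] (Fin n → R))
    (fun e => (φ e).rTensor (Fin n → R)) (fun e y => p.lTensor (M e) y = c e)
    (LinearMap.lTensor_surjective _ hp _) fun e y hy =>
      exists_rTensor_eq_and_lTensor_eq (hφ e) hp y (c (e + 1)) (hy.trans (hc e).symm)
  have hnat (e : ℕ) (y : M (e + 1) ⊗[R] (Fin n → R)) (i : Fin n) :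
      φ e (piScalarRight R R (M (e + 1)) (Fin n) y i) =
        piScalarRight R R (M e) (Fin n) ((φ e).rTensor _ y) i := by
    induction y with
    | zero => simp
    | tmul m r => simp
    | add y z hy hz => simp only [map_add, Pi.add_apply, hy, hz]
  have hsum (e : ℕ) (y : M e ⊗[R] (Fin n → R)) :
      ∑ i, piScalarRight R R (M e) (Fin n) y i ⊗ₜ[R] p (Pi.single i 1) = p.lTensor (M e) y := by
    induction y with
    | zero => simp
    | tmul m r =>
      simp only [piScalarRight_apply, piScalarRightHom_tmul, LinearMap.lTensor_tmul, smul_tmul,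
        ← tmul_sum, ← map_smul, ← map_sum]
      rw [← pi_eq_sum_univ' r]
    | add y z hy hz => simp only [map_add, Pi.add_apply, add_tmul, Finset.sum_add_distrib, hy, hz]
  let a (i : Fin n) : limL R M φ := ⟨fun e => piScalarRight R R (M e) (Fin n) (x e) i,
    (mem_limL_iff R M φ _).mpr fun e => by rw [hnat, hx]⟩
  refine ⟨∑ i, a i ⊗ₜ[R] p (Pi.single i 1), Subtype.ext (funext fun e => ?_)⟩
  calc (projL R M φ e).rTensor N (∑ i, a i ⊗ₜ[R] p (Pi.single i 1))
      = ∑ i, piScalarRight R R (M e) (Fin n) (x e) i ⊗ₜ[R] p (Pi.single i 1) := map_sum _ _ _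
    _ = c e := (hsum e (x e)).trans (hxc e)

end
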